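/- Let r be a maximal repetition in a word w and let σ be the principal repeat of r. If σ is a periodic repeat represented by a maximal repetition r′, then r′ coincides with r (as a fragment of w); hence the principal repeat of a maximal repetition cannot be represented by another maximal repetition. -/

import Mathlib

variable {A : Type*}

/-- `p` is a period of the factor `w[i..j]` of the word `w` (positions are 1-based):
`1 ≤ p ≤ j - i + 1` and `w[k] = w[k+p]` whenever both positions lie in `[i, j]`. -/
def IsPeriodOf (w : ℕ → A) (i j p : ℕ) : Prop :=
  1 ≤ p ∧ p ≤ j - i + 1 ∧ ∀ k, i ≤ k → k + p ≤ j → w k = w (k + p)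

/-- The minimal period of the factor `w[i..j]`. -/
noncomputable def minPer (w : ℕ → A) (i j : ℕ) : ℕ :=
  sInf {p | IsPeriodOf w i j p}

/-- The maximality conditions for a factor `w[i..j]` of the word `w` of length `n`,
with respect to its minimal period: it cannot be extended to the left or to the right
by one letter preserving the minimal period. -/
def MaxCond (n : ℕ) (w : ℕ → A) (i j : ℕ) : Prop :=
  (1 < i → w (i - 1) ≠ w (i + minPer w i j - 1)) ∧
  (j < n → w (j + 1) ≠ w (j - minPer w i j + 1))

/-- `w[i..j]` is a maximal repetition (run) in the word `w` of length `n`. -/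
def IsMaxRepetition (n : ℕ) (w : ℕ → A) (i j : ℕ) : Prop :=
  1 ≤ i ∧ i ≤ j ∧ j ≤ n ∧ 2 * minPer w i j ≤ j - i + 1 ∧ MaxCond n w i j

/-- `w[i..j]` is a maximal subrepetition in the word `w` of length `n`:
its exponent is strictly between 1 and 2 and it satisfies the maximality conditions. -/
def IsMaxSubrepetition (n : ℕ) (w : ℕ → A) (i j : ℕ) : Prop :=
  1 ≤ i ∧ i ≤ j ∧ j ≤ n ∧ minPer w i j < j - i + 1 ∧
    j - i + 1 < 2 * minPer w i j ∧ MaxCond n w i j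

/-- A repeat in the word `w` of length `n`: a pair of equal factors
`w[b1..e1]` (left copy) and `w[b2..e2]` (right copy) with `b1 < b2`. -/
structure WordRepeat (n : ℕ) (w : ℕ → A) where
  b1 : ℕ
  e1 : ℕ
  b2 : ℕ
  e2 : ℕ
  one_le_b1 : 1 ≤ b1
  b1_le_e1 : b1 ≤ e1
  b2_le_e2 : b2 ≤ e2
  e2_le_n : e2 ≤ n
  b1_lt_b2 : b1 < b2
  len_eq : e1 - b1 = e2 - b2
  copies_eq : ∀ k, k ≤ e1 - b1 → w (b1 + k) = w (b2 + k)

namespace WordRepeat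

variable {n : ℕ} {w : ℕ → A}

/-- The period of the repeat. -/
def p (σ : WordRepeat n w) : ℕ := σ.b2 - σ.b1

/-- The length of the copies of the repeat. -/
def c (σ : WordRepeat n w) : ℕ := σ.e1 - σ.b1 + 1

/-- The repeat is maximal: its copies cannot be simultaneously extended to the left
or to the right preserving the period. (`fact σ = w[b1..e2]`.) -/
def Maximal (σ : WordRepeat n w) : Prop :=
  (1 < σ.b1 → w (σ.b1 - 1) ≠ w (σ.b2 - 1)) ∧
  (σ.e2 < n → w (σ.e1 + 1) ≠ w (σ.e2 + 1))

/-- The repeat is overlapped: its copies are overlapped factors. -/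
def Overlapped (σ : WordRepeat n w) : Prop := σ.b2 ≤ σ.e1 + 1

/-- The repeat is gapped: there is a nonempty gap between its copies. -/
def Gapped (σ : WordRepeat n w) : Prop := σ.e1 + 1 < σ.b2

/-- The repeat is `α`-gapped: it is gapped and `p(σ) ≤ α ⬝ c(σ)`. -/
def AlphaGapped (α : ℝ) (σ : WordRepeat n w) : Prop :=
  σ.Gapped ∧ (σ.p : ℝ) ≤ α * (σ.c : ℝ)

/-- `σ` is covered by `σ'`: `fact σ = w[σ.b1..σ.e2]` is contained in
`fact σ' = w[σ'.b1..σ'.e2]` and `p(σ') < p(σ)`. -/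
def CoveredBy (σ σ' : WordRepeat n w) : Prop :=
  σ'.b1 ≤ σ.b1 ∧ σ.e2 ≤ σ'.e2 ∧ σ'.p < σ.p

end WordRepeat

/-- `σ` is the principal repeat of some maximal repetition of `w`
(a reprincipal repeat). -/
def IsPrincipalOfMaxRepetition {n : ℕ} {w : ℕ → A} (σ : WordRepeat n w) : Prop :=
  ∃ i j, IsMaxRepetition n w i j ∧ σ.b1 = i ∧ σ.e1 = j - minPer w i j ∧
    σ.b2 = i + minPer w i j ∧ σ.e2 = j

/-- `σ` is principal: it is the principal repeat of some maximal repetition or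
maximal subrepetition of `w`. -/
def IsPrincipal {n : ℕ} {w : ℕ → A} (σ : WordRepeat n w) : Prop :=
  ∃ i j, (IsMaxRepetition n w i j ∨ IsMaxSubrepetition n w i j) ∧ σ.b1 = i ∧
    σ.e1 = j - minPer w i j ∧ σ.b2 = i + minPer w i j ∧ σ.e2 = j

/-- `σ` is a periodic repeat: its copies are repetitions whose minimal period
is at most `c(σ)/3`. -/
def IsPeriodicRepeat {n : ℕ} {w : ℕ → A} (σ : WordRepeat n w) : Prop :=
  3 * minPer w σ.b1 σ.e1 ≤ σ.c

/-- The periodic repeat `σ` is represented by the maximal repetition `w[i..j]`: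
both copies of `σ` extend (preserving their minimal period) to `w[i..j]`;
equivalently, `w[i..j]` is a maximal repetition whose minimal period equals the
minimal period of the copies of `σ` and which contains both copies of `σ`. -/
def RepresentedBy {n : ℕ} {w : ℕ → A} (σ : WordRepeat n w) (i j : ℕ) : Prop :=
  IsPeriodicRepeat σ ∧ IsMaxRepetition n w i j ∧
  minPer w i j = minPer w σ.b1 σ.e1 ∧ i ≤ σ.b1 ∧ σ.e2 ≤ j

/-- The periodic repeat `σ` is represented by the pair of distinct maximal repetitions
`w[i1..j1]`, `w[i2..j2]`: the left copy of `σ` extends to `w[i1..j1]`, the right copy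
extends to `w[i2..j2]`, the two repetitions being distinct (`σ` is birepresented). -/
def RepresentedByPair {n : ℕ} {w : ℕ → A} (σ : WordRepeat n w)
    (i1 j1 i2 j2 : ℕ) : Prop :=
  IsPeriodicRepeat σ ∧ IsMaxRepetition n w i1 j1 ∧ IsMaxRepetition n w i2 j2 ∧
  minPer w i1 j1 = minPer w σ.b1 σ.e1 ∧ minPer w i2 j2 = minPer w σ.b1 σ.e1 ∧
  i1 ≤ σ.b1 ∧ σ.e1 ≤ j1 ∧ i2 ≤ σ.b2 ∧ σ.e2 ≤ j2 ∧ ¬(i1 = i2 ∧ j1 = j2)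


theorem isPeriodOf_minPer {w : ℕ → A} {i j : ℕ} (h : i ≤ j) :
    IsPeriodOf w i j (minPer w i j) := by
  have hne : {p | IsPeriodOf w i j p}.Nonempty :=
    ⟨j - i + 1, by omega, le_rfl, fun k hik hkj => by omega⟩
  exact Nat.sInf_mem hne

theorem IsPeriodOf.minPer_le {w : ℕ → A} {i j p : ℕ} (h : IsPeriodOf w i j p) :
    minPer w i j ≤ p :=
  Nat.sInf_le h

theorem IsPeriodOf.mono {w : ℕ → A} {i j i' j' p : ℕ} (h : IsPeriodOf w i' j' p)
    (hi : i' ≤ i) (hj : j ≤ j') (hp : p ≤ j - i + 1) : IsPeriodOf w i j p :=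
  ⟨h.1, hp, fun k hik hkj => h.2.2 k (hi.trans hik) (hkj.trans hj)⟩

/-- A maximal repetition cannot be properly extended preserving its minimal period. -/
theorem IsMaxRepetition.eq_of_isPeriodOf {n : ℕ} {w : ℕ → A} {i j i' j' : ℕ}
    (h : IsMaxRepetition n w i j) (hi' : 1 ≤ i') (hj' : j' ≤ n) (hi : i' ≤ i) (hj : j ≤ j')
    (hp : IsPeriodOf w i' j' (minPer w i j)) : i' = i ∧ j' = j := by
  obtain ⟨h1, hij, -, h2, hl, hr⟩ := h
  obtain ⟨-, -, hper⟩ := hp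
  constructor
  · by_contra hne
    apply hl (by omega)
    rw [hper (i - 1) (by omega) (by omega)]
    congr 1
    omega
  · by_contra hne
    apply hr (by omega)
    rw [hper (j - minPer w i j + 1) (by omega) (by omega)]
    congr 1
    omega

/-- The principal repeat of a maximal repetition cannot be represented by another
maximal repetition: if the principal repeat `σ` of a maximal repetition `w[i..j]` is a
periodic repeat represented by a maximal repetition `w[i'..j']`, then `i' = i` and
`j' = j`. -/
theorem principal_repeat_represented_only_by_itself {A : Type*} (n : ℕ) (w : ℕ → A)
    (i j : ℕ) (hr : IsMaxRepetition n w i j)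
    (σ : WordRepeat n w)
    (hσ : σ.b1 = i ∧ σ.e1 = j - minPer w i j ∧
      σ.b2 = i + minPer w i j ∧ σ.e2 = j)
    (i' j' : ℕ) (hrep : RepresentedBy σ i' j') :
    i' = i ∧ j' = j := by
  obtain ⟨hb1, he1, -, he2⟩ := hσ
  obtain ⟨hper, ⟨h1', hij', hn', -, -⟩, hmin, hi, hj⟩ := hrep
  have hij := hr.2.1
  have h2 := hr.2.2.2.1
  unfold IsPeriodicRepeat WordRepeat.c at hper
  rw [hb1] at hper hmin hi
  rw [he1] at hper hmin
  rw [he2] at hj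
  have hP := isPeriodOf_minPer (w := w) hij
  have hQ := isPeriodOf_minPer (w := w) hij'
  have hPQ : minPer w i j ≤ minPer w i' j' :=
    (hQ.mono hi hj (by omega)).minPer_le
  have hQP : minPer w i' j' ≤ minPer w i j :=
    hmin ▸ (hP.mono le_rfl (Nat.sub_le _ _) (by omega)).minPer_le
  exact hr.eq_of_isPeriodOf h1' hn' hi hj (le_antisymm hPQ hQP ▸ hQ)
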